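/- With the labeling λ of Π_{n,s+1}: for any interval I = [x, y] with 0̂ < x < y, if (k,i,j) is the lexicographically first triple with w^i_k(x) ≠ w^i_k(y) = j, then every maximal chain of I contains exactly one edge with label (k,i,j), and every edge label occurring in I is ≥ (k,i,j) in the lexicographic order on ℤ³. -/

import Mathlib

open Finset

/-- A vector partition of `[n]` into `s+1` components: a partition `P` of `[n]`
together with `s` labelings of its parts. -/
structure VPart (n s : ℕ) where
  P : Finpartition (Finset.univ : Finset (Fin n))
  w : Fin s → Finset (Fin n) → Finset (Fin n)
  card_w : ∀ i : Fin s, ∀ B ∈ P.parts, (w i B).card = B.card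
  part_w : ∀ i : Fin s, ∀ x : Fin n, ∃! B, B ∈ P.parts ∧ x ∈ w i B
  w_junk : ∀ i B, B ∉ P.parts → w i B = ∅

namespace VPart

variable {n s : ℕ}

@[ext] theorem ext' {x y : VPart n s} (hP : x.P = y.P) (hw : x.w = y.w) : x = y := by
  cases x; cases y; simp_all

/-- componentwise union-refinement order -/
instance : PartialOrder (VPart n s) where
  le x y := x.P ≤ y.P ∧
    ∀ i : Fin s, ∀ B ∈ x.P.parts, ∀ B' ∈ y.P.parts, B ⊆ B' → x.w i B ⊆ y.w i B'
  le_refl x := by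
    refine ⟨le_refl _, fun i B hB B' hB' hBB' => ?_⟩
    obtain rfl : B = B' := by
      obtain ⟨a, ha⟩ := x.P.nonempty_of_mem_parts hB
      exact x.P.eq_of_mem_parts hB hB' ha (hBB' ha)
    exact subset_rfl
  le_trans x y z hxy hyz := by
    refine ⟨le_trans hxy.1 hyz.1, fun i B hB B'' hB'' hBB'' => ?_⟩
    obtain ⟨B', hB', hBB'⟩ := hxy.1 hB
    obtain ⟨B''', hB''', hB'B'''⟩ := hyz.1 hB'
    obtain ⟨a, ha⟩ := x.P.nonempty_of_mem_parts hB
    obtain rfl : B''' = B'' :=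
      z.P.eq_of_mem_parts hB''' hB'' (hB'B''' (hBB' ha)) (hBB'' ha)
    exact subset_trans (hxy.2 i B hB B' hB' hBB') (hyz.2 i B' hB' B''' hB''' hB'B''')
  le_antisymm x y hxy hyx := by
    have hP : x.P = y.P := le_antisymm hxy.1 hyx.1
    refine ext' hP ?_
    funext i B
    by_cases hB : B ∈ x.P.parts
    · exact subset_antisymm (hxy.2 i B hB B (hP ▸ hB) subset_rfl)
        (hyx.2 i B (hP ▸ hB) B hB subset_rfl)
    · rw [x.w_junk i B hB, y.w_junk i B (hP ▸ hB)]

/-- the part of the underlying partition containing `k` -/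
def partOf (x : VPart n s) (k : Fin n) : Finset (Fin n) := x.P.part k

/-- the atom word of `x`: `atomWord x i k` is the element of the `i`-th label of the
part containing `k` whose rank in that label matches the rank of `k` in its part. -/
def atomWord (x : VPart n s) (i : Fin s) (k : Fin n) : Fin n :=
  (((x.w i (x.partOf k)).sort (· ≤ ·)).getD (((x.partOf k).filter (· < k)).card)) k

/-- `x` is an atom: all parts of the underlying partition are singletons. -/
def IsAtomic (x : VPart n s) : Prop := ∀ B ∈ x.P.parts, B.card = 1

/-- strict lexicographic order on atom words, with `i` as the major index
and `k` the minor index. -/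
def wordLt (A B : Fin s → Fin n → Fin n) : Prop :=
  ∃ i k, A i k < B i k ∧
    ∀ i' k', (i' < i ∨ (i' = i ∧ k' < k)) → A i' k' = B i' k'

def wordLe (A B : Fin s → Fin n → Fin n) : Prop := wordLt A B ∨ A = B

end VPart

/-- labels: `ℤ × ℤ × ℤ` with the lexicographic order -/
abbrev Lbl : Type := ℤ ×ₗ ℤ ×ₗ ℤ

def mkLbl (a b c : ℤ) : Lbl := toLex (a, toLex (b, c))

namespace VPart

variable {n s : ℕ}

set_option maxHeartbeats 1000000 in
open scoped Classical in
/-- the `(k,i,j)` label for an edge with distinct atom words (1-based) -/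
noncomputable def firstDiff (x y : VPart n s) : Lbl :=
  let D : Finset (Fin n × Fin s) :=
    Finset.univ.filter fun p => atomWord x p.2 p.1 ≠ atomWord y p.2 p.1
  if h : D.Nonempty then
    have hk : (D.image Prod.fst).Nonempty := h.image _
    let k := (D.image Prod.fst).min' hk
    have hk2 : ((D.filter fun p => p.1 = k).image Prod.snd).Nonempty := by
      obtain ⟨p, hp, hpk⟩ := Finset.mem_image.mp ((D.image Prod.fst).min'_mem hk)
      exact ⟨p.2, Finset.mem_image.mpr ⟨p, Finset.mem_filter.mpr ⟨hp, hpk⟩, rfl⟩⟩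
    let i := ((D.filter fun p => p.1 = k).image Prod.snd).min' hk2
    mkLbl ((k : ℕ) + 1) ((i : ℕ) + 1) ((atomWord y i k : ℕ) + 1)
  else mkLbl 0 0 0

/-- the maximum (1-based) of the union of the two merged parts -/
noncomputable def mergeMax (x y : VPart n s) : ℤ :=
  ((y.P.parts \ x.P.parts).sup fun B => B.sup fun t => (t : ℕ) + 1 : ℕ)

/-- the (1-based) index of an atom in the lexicographic order on atoms -/
noncomputable def atomIndex (a : VPart n s) : ℤ :=
  (Nat.card {a' : VPart n s // a'.IsAtomic ∧ wordLe (atomWord a') (atomWord a)} : ℤ)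

/-- The edge labeling `λ` of `Π_{n,s+1}` (on arbitrary pairs; only its values on
covering pairs are relevant). -/
noncomputable def lam : WithBot (VPart n s) → WithBot (VPart n s) → Lbl
  | ⊥, (y : VPart n s) => mkLbl ((n : ℤ) - 1) (s + atomIndex y) 0
  | (x : VPart n s), (y : VPart n s) =>
      if atomWord x = atomWord y then mkLbl n (mergeMax x y) 0 else firstDiff x y
  | _, _ => mkLbl 0 0 0

end VPart

/-- the word of edge labels along a list, for an edge labeling `f` -/
def labelWord {A B : Type*} (f : A -> A -> B) : List A -> List B
  | a :: b :: l => f a b :: labelWord f (b :: l)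
  | _ => []

/-- `L` is a saturated (covering) chain from `x` to `y`; these are exactly the
maximal chains of the interval `[x,y]`. -/
def CoverChain {A : Type*} [PartialOrder A] (x y : A) (L : List A) : Prop :=
  L.head? = some x ∧ L.getLast? = some y ∧ L.Chain' (fun a b => a ⋖ b)

namespace VPart

variable {n s : ℕ}

theorem partOf_mem (x : VPart n s) (k : Fin n) : x.partOf k ∈ x.P.parts :=
  x.P.part_mem.2 (Finset.mem_univ k)

theorem mem_partOf (x : VPart n s) (k : Fin n) : k ∈ x.partOf k :=
  x.P.mem_part (Finset.mem_univ k)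

theorem partOf_eq (x : VPart n s) {k : Fin n} {B : Finset (Fin n)} (hB : B ∈ x.P.parts)
    (hk : k ∈ B) : x.partOf k = B :=
  x.P.eq_of_mem_parts (x.partOf_mem k) hB (x.mem_partOf k) hk

theorem partOf_le {a b : VPart n s} (h : a ≤ b) (k : Fin n) : a.partOf k ⊆ b.partOf k := by
  obtain ⟨c, hc, hs⟩ := h.1 (a.partOf_mem k)
  rw [b.partOf_eq hc (hs (a.mem_partOf k))]
  exact hs

theorem rank_lt (x : VPart n s) (i : Fin s) (k : Fin n) :
    ((x.partOf k).filter (· < k)).card < ((x.w i (x.partOf k)).sort (· ≤ ·)).length := by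
  rw [Finset.length_sort, x.card_w i _ (x.partOf_mem k)]
  apply Finset.card_lt_card
  rw [Finset.filter_ssubset]
  exact ⟨k, x.mem_partOf k, lt_irrefl k⟩

theorem atomWord_eq (x : VPart n s) (i : Fin s) (k : Fin n) :
    atomWord x i k = ((x.w i (x.partOf k)).sort (· ≤ ·))[((x.partOf k).filter (· < k)).card]'
      (x.rank_lt i k) := by
  unfold atomWord
  rw [List.getD_eq_getElem]

theorem atomWord_mem (x : VPart n s) (i : Fin s) (k : Fin n) :
    atomWord x i k ∈ x.w i (x.partOf k) := by
  rw [atomWord_eq, ← Finset.mem_sort (· ≤ ·)]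
  exact List.getElem_mem _

theorem atomWord_lt (x : VPart n s) (i : Fin s) {t k : Fin n} (h : t ∈ x.partOf k) (htk : t < k) :
    atomWord x i t < atomWord x i k := by
  have hB : x.partOf t = x.partOf k := x.partOf_eq (x.partOf_mem k) h
  have hr : ((x.partOf k).filter (· < t)).card < ((x.partOf k).filter (· < k)).card := by
    apply Finset.card_lt_card
    rw [Finset.ssubset_iff_of_subset]
    · exact ⟨t, by simp [h, htk], by simp⟩
    · intro u hu
      simp only [Finset.mem_filter] at hu ⊢
      exact ⟨hu.1, hu.2.trans htk⟩
  have h1 := x.rank_lt i t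
  have h2 := x.rank_lt i k
  rw [atomWord_eq, atomWord_eq]
  simp only [hB] at h1 ⊢
  exact (Finset.sortedLT_sort (x.w i (x.partOf k))).strictMono_get
    (a := ⟨_, h1⟩) (b := ⟨_, h2⟩) hr

theorem atomWord_le (x : VPart n s) (i : Fin s) {t k : Fin n} (h : t ∈ x.partOf k) (htk : k ≤ t) :
    atomWord x i k ≤ atomWord x i t := by
  rcases htk.eq_or_lt with rfl | hlt
  · exact le_rfl
  · refine (atomWord_lt x i ?_ hlt).le
    rw [x.partOf_eq (x.partOf_mem k) h]
    exact x.mem_partOf k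

theorem atomWord_inj (x : VPart n s) (i : Fin s) : Function.Injective (atomWord x i) := by
  intro t k h
  have ht := x.atomWord_mem i t
  have hk := x.atomWord_mem i k
  rw [h] at ht
  have hB : x.partOf t = x.partOf k :=
    (x.part_w i (atomWord x i k)).unique ⟨x.partOf_mem t, ht⟩ ⟨x.partOf_mem k, hk⟩
  have h1 : t ∈ x.partOf k := hB ▸ x.mem_partOf t
  have h2 : k ∈ x.partOf t := hB ▸ x.mem_partOf k
  rcases lt_trichotomy t k with hlt | he | hlt
  · exact absurd h (x.atomWord_lt i h1 hlt).ne
  · exact he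
  · exact absurd h (x.atomWord_lt i h2 hlt).ne'

theorem exists_atomWord (x : VPart n s) (i : Fin s) (k v : Fin n)
    (hv : v ∈ x.w i (x.partOf k)) : ∃ t ∈ x.partOf k, atomWord x i t = v := by
  have := Finset.surj_on_of_inj_on_of_card_le (s := x.partOf k) (t := x.w i (x.partOf k))
    (fun t _ => atomWord x i t)
    (fun t ht => by
      have := x.atomWord_mem i t
      rwa [x.partOf_eq (x.partOf_mem k) ht] at this)
    (fun a b _ _ h => x.atomWord_inj i h)
    (by rw [x.card_w i _ (x.partOf_mem k)]) v hv
  obtain ⟨t, ht, h⟩ := this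
  exact ⟨t, ht, h.symm⟩

theorem core {a b : VPart n s} (h : a ≤ b) (i : Fin s) (k : Fin n)
    (hk : ∀ k' < k, atomWord a i k' = atomWord b i k') : atomWord b i k ≤ atomWord a i k := by
  have hm : atomWord a i k ∈ b.w i (b.partOf k) :=
    h.2 i _ (a.partOf_mem k) _ (b.partOf_mem k) (partOf_le h k) (a.atomWord_mem i k)
  obtain ⟨t, ht, he⟩ := b.exists_atomWord i k _ hm
  rw [← he]
  apply b.atomWord_le i ht
  by_contra hlt
  push Not at hlt
  rw [← hk t hlt] at he
  exact hlt.ne (a.atomWord_inj i he)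

theorem sandwich {x a y : VPart n s} (h1 : x ≤ a) (h2 : a ≤ y) (i : Fin s) (k : Fin n)
    (hk : ∀ k' < k, atomWord x i k' = atomWord y i k') :
    ∀ k' < k, atomWord a i k' = atomWord y i k' := by
  intro k'
  induction k' using WellFoundedLT.induction with
  | ind k' ih =>
    intro hlt
    have e : ∀ u < k', atomWord a i u = atomWord y i u := fun u hu => ih u hu (hu.trans hlt)
    apply le_antisymm
    · rw [← hk k' hlt]
      exact core h1 i k' fun u hu => (hk u (hu.trans hlt)).trans (e u hu).symm
    · exact core h2 i k' e

theorem not_last {x y : VPart n s} (i : Fin s) (k : Fin n)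
    (hp : atomWord x i k ≠ atomWord y i k)
    (hk : ∀ k' < k, atomWord x i k' = atomWord y i k') : (k : ℕ) + 1 < n := by
  by_contra hn
  obtain ⟨t, ht⟩ := Finite.surjective_of_injective (y.atomWord_inj i) (atomWord x i k)
  have htk : t ≠ k := fun h => hp (by rw [← ht, h])
  have : t < k := by
    have := t.2
    have : (t : ℕ) ≠ k := fun h => htk (Fin.ext h)
    rw [Fin.lt_def]; omega
  rw [← hk t this] at ht
  exact htk (x.atomWord_inj i ht)

theorem firstDiff_spec {a b : VPart n s} (h : atomWord a ≠ atomWord b) :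
    ∃ q : Fin n × Fin s, atomWord a q.2 q.1 ≠ atomWord b q.2 q.1 ∧
      (∀ q' : Fin n × Fin s, (q'.1 < q.1 ∨ (q'.1 = q.1 ∧ q'.2 < q.2)) →
        atomWord a q'.2 q'.1 = atomWord b q'.2 q'.1) ∧
      firstDiff a b = mkLbl ((q.1 : ℕ) + 1) ((q.2 : ℕ) + 1) ((atomWord b q.2 q.1 : ℕ) + 1) := by
  classical
  have hD : (Finset.univ.filter fun p : Fin n × Fin s =>
      atomWord a p.2 p.1 ≠ atomWord b p.2 p.1).Nonempty := by
    by_contra hne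
    apply h
    funext i k
    by_contra hh
    exact hne ⟨(k, i), by simpa using hh⟩
  unfold firstDiff
  dsimp only
  rw [dif_pos (by convert hD)]
  generalize_proofs h1 h2
  refine ⟨(Finset.min' _ h1, Finset.min' _ h2), ?_, ?_, rfl⟩
  · have := Finset.min'_mem _ h2
    simp only [Finset.mem_image, Finset.mem_filter, Finset.mem_univ, true_and] at this
    obtain ⟨q, ⟨hq, hq1⟩, hq2⟩ := this
    dsimp only
    rw [← hq2, ← hq1]
    exact hq
  · rintro ⟨k, i⟩ hq
    by_contra hne
    dsimp only at hq hne
    rcases hq with hq | ⟨hq, hq'⟩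
    · refine absurd (Finset.min'_le _ k ?_) (not_le.2 hq)
      simp only [Finset.mem_image, Finset.mem_filter, Finset.mem_univ, true_and]
      exact ⟨(k, i), hne, rfl⟩
    · refine absurd (Finset.min'_le _ i ?_) (not_le.2 hq')
      simp only [Finset.mem_image, Finset.mem_filter, Finset.mem_univ, true_and]
      exact ⟨(k, i), ⟨hne, hq⟩, rfl⟩

theorem mkLbl_le {a b c a' b' c' : ℤ} :
    mkLbl a b c ≤ mkLbl a' b' c' ↔ a < a' ∨ a = a' ∧ (b < b' ∨ b = b' ∧ c ≤ c') := by
  simp [mkLbl, Prod.Lex.toLex_le_toLex]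

theorem mkLbl_inj {a b c a' b' c' : ℤ} :
    mkLbl a b c = mkLbl a' b' c' ↔ a = a' ∧ b = b' ∧ c = c' := by
  simp [mkLbl]

theorem lam_coe (a b : VPart n s) [Decidable (atomWord a = atomWord b)] :
    lam (a : WithBot (VPart n s)) (b : WithBot (VPart n s)) =
      if atomWord a = atomWord b then mkLbl n (mergeMax a b) 0 else firstDiff a b := by
  have : lam (a : WithBot (VPart n s)) (b : WithBot (VPart n s)) =
      @ite _ (atomWord a = atomWord b) (Classical.propDecidable _)
        (mkLbl n (mergeMax a b) 0) (firstDiff a b) := by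
    simp only [lam]
    congr
  rw [this]
  congr

/-- All facts about points of the interval. -/
theorem interval_facts {x y : VPart n s} (p : Fin n × Fin s)
    (hmin : ∀ q : Fin n × Fin s, (q.1 < p.1 ∨ (q.1 = p.1 ∧ q.2 < p.2)) ->
      atomWord x q.2 q.1 = atomWord y q.2 q.1) {a : VPart n s} (h1 : x ≤ a) (h2 : a ≤ y) :
    (∀ q : Fin n × Fin s, (q.1 < p.1 ∨ (q.1 = p.1 ∧ q.2 < p.2)) ->
      atomWord a q.2 q.1 = atomWord y q.2 q.1) := by
  have hk : ∀ i : Fin s, ∀ k' < p.1, atomWord x i k' = atomWord y i k' :=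
    fun i k' h => hmin (k', i) (Or.inl h)
  have hs := fun i => sandwich h1 h2 i p.1 (hk i)
  rintro ⟨k, i⟩ hq
  dsimp only at hq ⊢
  rcases hq with hq | ⟨rfl, hq⟩
  · exact hs i k hq
  · apply le_antisymm
    · rw [← hmin (p.1, i) (Or.inr ⟨rfl, hq⟩)]
      exact core h1 i p.1 fun u hu => (hk i u hu).trans (hs i u hu).symm
    · exact core h2 i p.1 (hs i)

theorem edge_facts {x y : VPart n s} (p : Fin n × Fin s)
    (hp : atomWord x p.2 p.1 ≠ atomWord y p.2 p.1)
    (hmin : ∀ q : Fin n × Fin s, (q.1 < p.1 ∨ (q.1 = p.1 ∧ q.2 < p.2)) ->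
      atomWord x q.2 q.1 = atomWord y q.2 q.1) {a b : VPart n s} (h1 : x ≤ a) (hab : a ≤ b)
    (h2 : b ≤ y) :
    (mkLbl ((p.1 : ℕ) + 1) ((p.2 : ℕ) + 1) ((atomWord y p.2 p.1 : ℕ) + 1) ≤
        lam (a : WithBot (VPart n s)) (b : WithBot (VPart n s))) ∧
    (lam (a : WithBot (VPart n s)) (b : WithBot (VPart n s)) =
      mkLbl ((p.1 : ℕ) + 1) ((p.2 : ℕ) + 1) ((atomWord y p.2 p.1 : ℕ) + 1) ↔
      atomWord a p.2 p.1 ≠ atomWord y p.2 p.1 ∧ atomWord b p.2 p.1 = atomWord y p.2 p.1) ∧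
    (atomWord a p.2 p.1 = atomWord y p.2 p.1 → atomWord b p.2 p.1 = atomWord y p.2 p.1) := by
  classical
  have ha := interval_facts p hmin h1 (hab.trans h2)
  have hb := interval_facts p hmin (h1.trans hab) h2
  have hby : atomWord y p.2 p.1 ≤ atomWord b p.2 p.1 :=
    core h2 p.2 p.1 fun u hu => hb (u, p.2) (Or.inl hu)
  have hba : atomWord b p.2 p.1 ≤ atomWord a p.2 p.1 :=
    core hab p.2 p.1 fun u hu =>
      (ha (u, p.2) (Or.inl hu)).trans (hb (u, p.2) (Or.inl hu)).symm
  have hn := not_last p.2 p.1 hp (fun k' h => hmin (k', p.2) (Or.inl h))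
  refine ⟨?_, ?_, fun h => le_antisymm (h ▸ hba) hby⟩
  · rw [lam_coe]
    split_ifs with he
    · rw [mkLbl_le]; left; exact_mod_cast hn
    · obtain ⟨q, hq, hqm, hf⟩ := firstDiff_spec he
      rw [hf, mkLbl_le]
      have hnq : ¬ (q.1 < p.1 ∨ (q.1 = p.1 ∧ q.2 < p.2)) := fun h =>
        hq ((ha q h).trans (hb q h).symm)
      push Not at hnq
      rcases hnq.1.lt_or_eq with hlt | heq
      · left
        rw [Fin.lt_def] at hlt; omega
      · refine Or.inr ⟨by rw [heq], ?_⟩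
        rcases (hnq.2 heq.symm).lt_or_eq with hlt | heq'
        · left
          rw [Fin.lt_def] at hlt; omega
        · refine Or.inr ⟨by rw [heq'], ?_⟩
          rw [← heq, ← heq']
          rw [Fin.le_def] at hby; omega
  · rw [lam_coe]
    split_ifs with he
    · rw [mkLbl_inj, he]
      constructor
      · rintro ⟨h, -, -⟩; omega
      · rintro ⟨h, h'⟩; exact absurd h' h
    · obtain ⟨q, hq, hqm, hf⟩ := firstDiff_spec he
      rw [hf, mkLbl_inj]
      constructor
      · rintro ⟨e1, e2, e3⟩
        have e1' : q.1 = p.1 := by apply Fin.ext; omega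
        have e2' : q.2 = p.2 := by apply Fin.ext; omega
        rw [e1', e2'] at hq e3
        have e3' : atomWord b p.2 p.1 = atomWord y p.2 p.1 := by apply Fin.ext; omega
        exact ⟨fun h => hq (h.trans e3'.symm), e3'⟩
      · rintro ⟨g1, g2⟩
        have hqp : q = p := by
          have hnq : ¬ (q.1 < p.1 ∨ (q.1 = p.1 ∧ q.2 < p.2)) := fun h =>
            hq ((ha q h).trans (hb q h).symm)
          have hnp : ¬ (p.1 < q.1 ∨ (p.1 = q.1 ∧ p.2 < q.2)) := fun h =>
            g1 ((hqm p h).trans g2)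
          push Not at hnq hnp
          have e1 := le_antisymm hnp.1 hnq.1
          exact Prod.ext e1 (le_antisymm (hnp.2 e1.symm) (hnq.2 e1))
        subst hqp
        exact ⟨rfl, rfl, by rw [g2]⟩

theorem chain_le {A : Type*} [PartialOrder A] {y : A} : ∀ (L : List A) (a : A),
    CoverChain a y (a :: L) → a ≤ y := by
  intro L
  induction L with
  | nil => intro a h; have := h.2.1; simp at this; exact this.le
  | cons b L ih =>
    intro a h
    obtain ⟨-, h2, h3⟩ := h
    have h3' := List.isChain_cons_cons.1 h3
    exact h3'.1.le.trans (ih b ⟨rfl, by simpa using h2, h3'.2⟩)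

open scoped Classical in
theorem chain_count {x y : VPart n s} (p : Fin n × Fin s)
    (hp : atomWord x p.2 p.1 ≠ atomWord y p.2 p.1)
    (hmin : ∀ q : Fin n × Fin s, (q.1 < p.1 ∨ (q.1 = p.1 ∧ q.2 < p.2)) ->
      atomWord x q.2 q.1 = atomWord y q.2 q.1) :
    ∀ (L : List (VPart n s)) (a : VPart n s), x ≤ a → CoverChain a y (a :: L) →
      (labelWord (fun a b : WithBot (VPart n s) => lam a b)
        (List.map (fun v : VPart n s => (v : WithBot (VPart n s))) (a :: L))).count
        (mkLbl ((p.1 : ℕ) + 1) ((p.2 : ℕ) + 1) ((atomWord y p.2 p.1 : ℕ) + 1)) =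
      if atomWord a p.2 p.1 = atomWord y p.2 p.1 then 0 else 1 := by
  intro L
  induction L with
  | nil =>
    intro a _ h
    have := h.2.1
    simp at this
    simp [labelWord, this]
  | cons b L ih =>
    intro a hxa h
    obtain ⟨-, h2, h3⟩ := h
    have h3' := List.isChain_cons_cons.1 h3
    have hc : CoverChain b y (b :: L) := ⟨rfl, by simpa using h2, h3'.2⟩
    have hby := chain_le L b hc
    obtain ⟨-, e2, e3⟩ := edge_facts p hp hmin hxa h3'.1.le hby
    have hi := ih b (hxa.trans h3'.1.le) hc
    rw [List.map_cons] at hi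
    rw [List.map_cons, List.map_cons]
    rw [labelWord, List.count_cons, hi]
    simp only [beq_iff_eq, e2]
    by_cases g1 : atomWord a p.2 p.1 = atomWord y p.2 p.1
    · simp [g1, e3 g1]
    · by_cases g2 : atomWord b p.2 p.1 = atomWord y p.2 p.1 <;> simp [g1, g2]

end VPart

open VPart in
open scoped Classical in
/-- in an interval `[x, y]` with `̄0 < x < y`, if `(k, i, j)` is the
lexicographically first triple where the atom words of `x` and `y` differ (here
`p = (k, i)`, `j = atomWord y p.2 p.1`), then every maximal chain of the interval
contains exactly one edge with label `(k, i, j)`, and every edge label in the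
interval is `≥ (k, i, j)`. -/
theorem statement12 (n s : ℕ) (x y : VPart n s) (hxy : x < y)
    (p : Fin n × Fin s)
    (hp : atomWord x p.2 p.1 ≠ atomWord y p.2 p.1)
    (hmin : ∀ q : Fin n × Fin s, (q.1 < p.1 ∨ (q.1 = p.1 ∧ q.2 < p.2)) ->
      atomWord x q.2 q.1 = atomWord y q.2 q.1) :
    (∀ L : List (VPart n s), CoverChain x y L ->
      (labelWord (fun a b => lam (a : WithBot (VPart n s)) (b : WithBot (VPart n s))) L).count
        (mkLbl ((p.1 : ℕ) + 1) ((p.2 : ℕ) + 1) ((atomWord y p.2 p.1 : ℕ) + 1)) = 1) ∧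
    ∀ a b : VPart n s, x ≤ a -> a ⋖ b -> b ≤ y ->
      mkLbl ((p.1 : ℕ) + 1) ((p.2 : ℕ) + 1) ((atomWord y p.2 p.1 : ℕ) + 1) ≤
        lam (a : WithBot (VPart n s)) (b : WithBot (VPart n s)) := by
  constructor
  · intro L hL
    cases L with
    | nil => simp [CoverChain] at hL
    | cons a L =>
      obtain rfl : a = x := by simpa using hL.1
      have := chain_count p hp hmin L a le_rfl hL
      rw [if_neg hp] at this
      convert this using 3
      simp only [List.bind_eq_flatMap]
      exact List.flatMap_pure_eq_map _ _
  · intro a b hxa hab hby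
    exact (edge_facts p hp hmin hxa hab.le hby).1
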